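/- Let B be a real 2×2 matrix with τ := trace(B) ≠ 0, let d, v ∈ ℝ², let β > 0, and define the reparametrized curve c̃(s) := v + F_B((3/τ)·ln(τ s/(3β)))(Bv + d) for all real s with τ s > 0. Then for all such s, c̃''(s) = (1/s)·((3/τ)B − I)(c̃'(s)) and c̃'''(s) = −(9·det(B)/τ² − 2)·(1/s²)·c̃'(s). -/

import Mathlib

open Matrix

/-- The matrix power series `F_B(t) = ∑_{k=1}^∞ (t^k/k!) B^(k-1)`. -/
noncomputable def Fmat {n : ℕ} (B : Matrix (Fin n) (Fin n) ℝ) (t : ℝ) :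
    Matrix (Fin n) (Fin n) ℝ :=
  ∑' k : ℕ, ((t ^ (k + 1) / (k + 1).factorial : ℝ)) • B ^ k

open scoped Nat in
/-- The primitive `∑ t^(k+1)/(k+1)! • b^k` of `t ↦ exp (t • b)` in a Banach algebra. -/
theorem hasDerivAt_tsum_pow_succ_div_factorial_smul {A : Type*} [NormedRing A]
    [NormedAlgebra ℝ A] [CompleteSpace A] (b : A) (t : ℝ) :
    HasDerivAt (fun t : ℝ => ∑' k : ℕ, (t ^ (k + 1) / (k + 1)! : ℝ) • b ^ k)
      (NormedSpace.exp (t • b)) t := by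
  have hexp : NormedSpace.exp (t • b) = ∑' k : ℕ, (t ^ k / k ! : ℝ) • b ^ k := by
    rw [NormedSpace.exp_eq_tsum ℝ]
    refine tsum_congr fun k => ?_
    rw [smul_pow, smul_smul, div_eq_inv_mul]
  rw [hexp]
  have hr : 0 < |t| + 1 := by positivity
  refine hasDerivAt_tsum_of_isPreconnected
    (g := fun k (t : ℝ) => (t ^ (k + 1) / (k + 1)! : ℝ) • b ^ k)
    (g' := fun k t => (t ^ k / k ! : ℝ) • b ^ k)
    (NormedSpace.norm_expSeries_summable' (𝕂 := ℝ) ((|t| + 1) • b))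
    (Metric.isOpen_ball (x := (0 : ℝ)) (ε := |t| + 1))
    (convex_ball (0 : ℝ) (|t| + 1)).isPreconnected
    (fun k y _ => ?_) (fun k y hy => ?_) (Metric.mem_ball_self hr) ?_
    (by simp)
  · refine HasDerivAt.smul_const ?_ (b ^ k)
    convert (hasDerivAt_pow (k + 1) y).div_const ((k + 1)! : ℝ) using 1
    rw [Nat.factorial_succ]
    push_cast
    field_simp
  · have hy' : |y| ≤ |t| + 1 := by simpa using (Metric.mem_ball.1 hy).le
    rw [smul_pow, smul_smul, ← div_eq_inv_mul, norm_smul, norm_smul]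
    gcongr
    rw [norm_div, norm_div, norm_pow, norm_pow, Real.norm_eq_abs, Real.norm_of_nonneg hr.le]
    gcongr
  · simp

section MatrixCurves

variable {n : ℕ} (B : Matrix (Fin n) (Fin n) ℝ) (w : Fin n → ℝ) (t : ℝ)

open scoped Matrix.Norms.Operator in
theorem hasDerivAt_Fmat_mulVec :
    HasDerivAt (fun t => Fmat B t *ᵥ w) (NormedSpace.exp (t • B) *ᵥ w) t :=
  (LinearMap.toContinuousLinearMap
    ((mulVecBilin ℝ ℝ).flip w : Matrix (Fin n) (Fin n) ℝ →ₗ[ℝ] Fin n → ℝ)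
    ).hasFDerivAt.comp_hasDerivAt t (hasDerivAt_tsum_pow_succ_div_factorial_smul B t)

open scoped Matrix.Norms.Operator in
theorem hasDerivAt_exp_smul_mulVec :
    HasDerivAt (fun t : ℝ => NormedSpace.exp (t • B) *ᵥ w)
      (B *ᵥ (NormedSpace.exp (t • B) *ᵥ w)) t := by
  rw [mulVec_mulVec]
  exact (LinearMap.toContinuousLinearMap
    ((mulVecBilin ℝ ℝ).flip w : Matrix (Fin n) (Fin n) ℝ →ₗ[ℝ] Fin n → ℝ)
    ).hasFDerivAt.comp_hasDerivAt t (hasDerivAt_exp_smul_const' B t)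

end MatrixCurves

theorem hasDerivAt_mulVec {n : ℕ} (A : Matrix (Fin n) (Fin n) ℝ) {f : ℝ → Fin n → ℝ}
    {f' : Fin n → ℝ} {s : ℝ} (hf : HasDerivAt f f' s) :
    HasDerivAt (fun s => A *ᵥ f s) (A *ᵥ f') s :=
  (LinearMap.toContinuousLinearMap A.mulVecLin).hasFDerivAt.comp_hasDerivAt s hf

/-- Cayley–Hamilton for `2 × 2` matrices, applied to a vector. -/
theorem mulVec_mulVec_fin_two (B : Matrix (Fin 2) (Fin 2) ℝ) (x : Fin 2 → ℝ) :
    B *ᵥ (B *ᵥ x) = B.trace • (B *ᵥ x) - B.det • x := by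
  ext i
  fin_cases i <;> simp [mulVec, dotProduct, trace_fin_two, det_fin_two] <;> ring

/-- A curve satisfying `f' = (1/s) A f` on an open set has `f'' = (1/s²) (A² - A) f` there. -/
theorem hasDerivAt_inv_smul_mulVec {n : ℕ} (A : Matrix (Fin n) (Fin n) ℝ) {f : ℝ → Fin n → ℝ}
    {s : ℝ} (hs : s ≠ 0) (hf : HasDerivAt f ((1 / s) • A *ᵥ f s) s) :
    HasDerivAt (fun s => (1 / s) • A *ᵥ f s)
      ((1 / s ^ 2) • (A *ᵥ (A *ᵥ f s) - A *ᵥ f s)) s := by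
  have hinv : HasDerivAt (fun s : ℝ => 1 / s) (-(1 / s ^ 2)) s := by
    simpa [one_div] using hasDerivAt_inv hs
  refine (hinv.smul (hasDerivAt_mulVec A hf)).congr_deriv ?_
  rw [mulVec_smul]
  module

theorem stmt_13 (B : Matrix (Fin 2) (Fin 2) ℝ) (d v : Fin 2 → ℝ)
    (τ : ℝ) (hτ : τ = B.trace) (hτ0 : τ ≠ 0) (β : ℝ) (hβ : 0 < β) :
    let ctilde : ℝ → Fin 2 → ℝ := fun s =>
      v + (Fmat B ((3 / τ) * Real.log (τ * s / (3 * β)))).mulVec (B.mulVec v + d)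
    ∀ s : ℝ, 0 < τ * s →
      deriv (deriv ctilde) s =
        (1 / s) • ((3 / τ) • B - 1).mulVec (deriv ctilde s) ∧
      deriv (deriv (deriv ctilde)) s =
        -((9 * B.det / τ ^ 2 - 2)) • ((1 / s ^ 2) • deriv ctilde s) := by
  intro ctilde s hs
  set w := B *ᵥ v + d
  set φ : ℝ → ℝ := fun s => (3 / τ) * Real.log (τ * s / (3 * β))
  set A := (3 / τ) • B - 1 with hA
  have hU : IsOpen {s : ℝ | 0 < τ * s} := isOpen_lt continuous_const (by fun_prop)
  have hne : ∀ {s : ℝ}, 0 < τ * s → s ≠ 0 := fun h => right_ne_zero_of_mul h.ne'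
  have hφ : ∀ s, 0 < τ * s → HasDerivAt φ ((3 / τ) * (1 / s)) s := fun s hs => by
    have hlin : HasDerivAt (fun s : ℝ => τ * s / (3 * β)) (τ / (3 * β)) s := by
      simpa using ((hasDerivAt_id s).const_mul τ).div_const (3 * β)
    have hs0 := hne hs
    refine ((hlin.log (by positivity)).const_mul (3 / τ)).congr_deriv ?_
    field_simp
  have hd1 : ∀ s, 0 < τ * s →
      HasDerivAt ctilde ((1 / s) • (3 / τ) • (NormedSpace.exp (φ s • B) *ᵥ w)) s :=
    fun s hs => by
      refine (((hasDerivAt_Fmat_mulVec B w (φ s)).scomp s (hφ s hs)).const_add v).congr_deriv ?_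
      module
  have hd2 : ∀ s, 0 < τ * s →
      HasDerivAt (deriv ctilde) ((1 / s) • A *ᵥ deriv ctilde s) s := fun s hs => by
    have heq : deriv ctilde =ᶠ[nhds s]
        fun s => (1 / s) • (3 / τ) • (NormedSpace.exp (φ s • B) *ᵥ w) := by
      filter_upwards [hU.mem_nhds hs] with u hu using (hd1 u hu).deriv
    refine HasDerivAt.congr_of_eventuallyEq ?_ heq
    have hinv : HasDerivAt (fun s : ℝ => 1 / s) (-(1 / s ^ 2)) s := by
      simpa [one_div] using hasDerivAt_inv (hne hs)
    refine (hinv.smul (((hasDerivAt_exp_smul_mulVec B w (φ s)).scomp s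
      (hφ s hs)).const_smul (3 / τ))).congr_deriv ?_
    rw [(hd1 s hs).deriv, hA, sub_mulVec, one_mulVec, smul_mulVec, mulVec_smul, mulVec_smul]
    simp only [Function.comp_apply, Pi.smul_apply]
    module
  refine ⟨(hd2 s hs).deriv, ?_⟩
  have heq : deriv (deriv ctilde) =ᶠ[nhds s] fun s => (1 / s) • A *ᵥ deriv ctilde s := by
    filter_upwards [hU.mem_nhds hs] with u hu using (hd2 u hu).deriv
  rw [heq.deriv_eq, (hasDerivAt_inv_smul_mulVec A (hne hs) (hd2 s hs)).deriv]
  simp only [hA, sub_mulVec, one_mulVec, smul_mulVec, mulVec_sub, mulVec_smul,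
    mulVec_mulVec_fin_two, ← hτ]
  match_scalars <;> field_simp <;> ring
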